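/- arXiv:0807.2705 — 3 statements merged into one kernel-verified Lean document; each statement's English description precedes it below -/
import Mathlib

section
/- Let (X,d) be a metric space whose underlying set X is infinite. Then the (normalized) 0-negative type gap of (X,d) is zero: Γ_X^0 = 0. Equivalently, for every ε > 0 there exists a normalized (q,t)-simplex D(ω) in X with γ_D^0(ω) < ε. -/
/-- Over a linearly ordered finite index type, the square of a sum splits into its diagonal
part and twice its strictly upper triangular part. -/
theorem two_mul_sum_sum_ite_lt {ι R : Type*} [Fintype ι] [LinearOrder ι] [CommRing R]
    (f : ι → R) :
    2 * (∑ i, ∑ j, if i < j then f i * f j else 0) = (∑ i, f i) ^ 2 - ∑ i, f i ^ 2 := by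
  have hswap : (∑ i, ∑ j, if i < j then f i * f j else 0)
      = ∑ i, ∑ j, if j < i then f i * f j else 0 := by
    rw [Finset.sum_comm]
    simp only [mul_comm]
  have hdiag : ∑ i, f i ^ 2 = ∑ i, ∑ j, if i = j then f i * f j else 0 := by
    simp [sq]
  rw [two_mul, eq_sub_iff_add_eq, hdiag, sq, Finset.sum_mul_sum]
  nth_rw 2 [hswap]
  simp only [← Finset.sum_add_distrib]
  refine Finset.sum_congr rfl fun i _ => Finset.sum_congr rfl fun j _ => ?_
  rcases lt_trichotomy i j with h | h | h
  · simp [h, h.not_gt, h.ne]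
  · simp [h]
  · simp [h, h.not_gt, h.ne']

/-- For normalized loads the `0`-negative type simplex gap is half the sum of the squared
loads. -/
theorem zero_simplex_gap_eq {q t : ℕ} {m : Fin q → ℝ} {n : Fin t → ℝ}
    (hm : ∑ j, m j = 1) (hn : ∑ i, n i = 1) :
    1 - (∑ j₁ : Fin q, ∑ j₂ : Fin q, if j₁ < j₂ then m j₁ * m j₂ else 0)
      - (∑ i₁ : Fin t, ∑ i₂ : Fin t, if i₁ < i₂ then n i₁ * n i₂ else 0)
      = (∑ j, m j ^ 2 + ∑ i, n i ^ 2) / 2 := by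
  have h₁ := two_mul_sum_sum_ite_lt m
  have h₂ := two_mul_sum_sum_ite_lt n
  rw [hm] at h₁
  rw [hn] at h₂
  linarith

/-- Corollary 3.5: no infinite metric space has a positive `0`-negative type
gap.  The infimum over all normalized `(q,t)`-simplices `D(ω)` in `X` of
`γ_D^0(ω) = 1 − Σ_{j₁<j₂} m_{j₁}m_{j₂} − Σ_{i₁<i₂} n_{i₁}n_{i₂}` is zero; equivalently,
for every `ε > 0` there is a normalized simplex whose `0`-gap is `< ε`. -/
theorem zero_gap_infinite {X : Type*} [MetricSpace X] [Infinite X] :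
    IsGLB {v : ℝ | ∃ (q t : ℕ) (_ : 0 < q) (_ : 0 < t)
        (a : Fin q → X) (b : Fin t → X) (_ : Function.Injective (Sum.elim a b))
        (m : Fin q → ℝ) (n : Fin t → ℝ),
        (∀ j, 0 < m j) ∧ (∀ i, 0 < n i) ∧ (∑ j, m j = 1) ∧ (∑ i, n i = 1) ∧
        v = 1 - (∑ j₁ : Fin q, ∑ j₂ : Fin q, if j₁ < j₂ then m j₁ * m j₂ else 0)
              - (∑ i₁ : Fin t, ∑ i₂ : Fin t, if i₁ < i₂ then n i₁ * n i₂ else 0)}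
      (0 : ℝ) ∧
    ∀ ε : ℝ, 0 < ε →
      ∃ (q t : ℕ) (_ : 0 < q) (_ : 0 < t)
        (a : Fin q → X) (b : Fin t → X) (_ : Function.Injective (Sum.elim a b))
        (m : Fin q → ℝ) (n : Fin t → ℝ),
        (∀ j, 0 < m j) ∧ (∀ i, 0 < n i) ∧ (∑ j, m j = 1) ∧ (∑ i, n i = 1) ∧
        1 - (∑ j₁ : Fin q, ∑ j₂ : Fin q, if j₁ < j₂ then m j₁ * m j₂ else 0)
          - (∑ i₁ : Fin t, ∑ i₂ : Fin t, if i₁ < i₂ then n i₁ * n i₂ else 0) < ε := by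
  have small : ∀ ε : ℝ, 0 < ε →
      ∃ (q t : ℕ) (_ : 0 < q) (_ : 0 < t)
        (a : Fin q → X) (b : Fin t → X) (_ : Function.Injective (Sum.elim a b))
        (m : Fin q → ℝ) (n : Fin t → ℝ),
        (∀ j, 0 < m j) ∧ (∀ i, 0 < n i) ∧ (∑ j, m j = 1) ∧ (∑ i, n i = 1) ∧
        1 - (∑ j₁ : Fin q, ∑ j₂ : Fin q, if j₁ < j₂ then m j₁ * m j₂ else 0)
          - (∑ i₁ : Fin t, ∑ i₂ : Fin t, if i₁ < i₂ then n i₁ * n i₂ else 0) < ε := by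
    intro ε hε
    obtain ⟨k, hk⟩ := exists_nat_one_div_lt hε
    have hpos : (0 : ℝ) < 1 / ((k : ℝ) + 1) := Nat.one_div_pos_of_nat
    have hsum : ∑ _j : Fin (k + 1), 1 / ((k : ℝ) + 1) = 1 := by
      simp
      field_simp
    let e : Fin (k + 1) ⊕ Fin (k + 1) ↪ X :=
      finSumFinEquiv.toEmbedding.trans (Fin.valEmbedding.trans (Infinite.natEmbedding X))
    refine ⟨k + 1, k + 1, k.succ_pos, k.succ_pos, e ∘ Sum.inl, e ∘ Sum.inr, ?_,
      fun _ => 1 / ((k : ℝ) + 1), fun _ => 1 / ((k : ℝ) + 1),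
      fun _ => hpos, fun _ => hpos, hsum, hsum, ?_⟩
    · rw [Sum.elim_comp_inl_inr]
      exact e.injective
    · rw [zero_simplex_gap_eq hsum hsum, add_self_div_two]
      simp only [sq, ← Finset.mul_sum, hsum, mul_one]
      exact hk
  refine ⟨⟨?_, fun c hc => ?_⟩, small⟩
  · rintro v ⟨q, t, -, -, a, b, -, m, n, -, -, hm, hn, rfl⟩
    rw [zero_simplex_gap_eq hm hn]
    positivity
  · refine le_of_forall_pos_lt_add fun ε hε => ?_
    obtain ⟨q, t, hq, ht, a, b, hab, m, n, hm, hn, hm1, hn1, hlt⟩ := small ε hε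
    rw [zero_add]
    exact (hc ⟨q, t, hq, ht, a, b, hab, m, n, hm, hn, hm1, hn1, rfl⟩).trans_lt hlt
end

section
/- Let n ≥ 3 be an integer and 𝔇 ∈ (1,2]. Then there exists an n-point metric space (X,d) with scaled diameter (diam X)/min{d(x,y) : x ≠ y} = 𝔇 whose maximal p-negative type is exactly ζ(n,𝔇) = ln(1/(1−Γ))/ln 𝔇, where Γ = (1/2)(1/⌊n/2⌋ + 1/⌈n/2⌉): namely, (X,d) has p-negative type for all 0 ≤ p ≤ ζ(n,𝔇) and fails to have p-negative type for all p > ζ(n,𝔇). One such space is X = {a_1,…,a_q,b_1,…,b_t} with q = ⌊n/2⌋, t = ⌈n/2⌉, d(a_j,b_i) = 1 for all i,j, and all distances within {a_1,…,a_q} and within {b_1,…,b_t} equal to 𝔇. -/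
open Finset

/-- The metric on `Fin n` for which distinct points on the same side of the cut at `n / 2` are at
distance `D` and points on different sides are at distance `1`. -/
noncomputable def bipartiteDist (n : ℕ) (D : ℝ) (x y : Fin n) : ℝ :=
  if x = y then 0 else if (x.val < n / 2 ↔ y.val < n / 2) then D else 1

lemma card_lower_half (n : ℕ) : #{v : Fin n | v.val < n / 2} = n / 2 := by
  rw [Fin.card_filter_val_lt]
  omega

lemma card_upper_half (n : ℕ) : #{v : Fin n | ¬ v.val < n / 2} = (n + 1) / 2 := by
  have h := card_filter_add_card_filter_not (s := (univ : Finset (Fin n)))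
    (fun v => v.val < n / 2)
  rw [card_lower_half, card_univ, Fintype.card_fin] at h
  omega

lemma bipartiteDist_quadratic_form {ι : Type*} [Fintype ι] [DecidableEq ι] {n : ℕ} (D p : ℝ)
    {x : ι → Fin n} (hx : Function.Injective x) (η : ι → ℝ) :
    ∑ i, ∑ j, (if i = j then 0 else bipartiteDist n D (x i) (x j) ^ p * (η i * η j)) =
      D ^ p * ((∑ i with (x i).val < n / 2, η i) ^ 2 - ∑ i with (x i).val < n / 2, η i ^ 2) +
      D ^ p * ((∑ i with ¬ (x i).val < n / 2, η i) ^ 2 - ∑ i with ¬ (x i).val < n / 2, η i ^ 2) +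
      2 * ((∑ i with (x i).val < n / 2, η i) * ∑ i with ¬ (x i).val < n / 2, η i) := by
  set a : ι → ℝ := fun i => if (x i).val < n / 2 then η i else 0 with ha
  set b : ι → ℝ := fun i => if (x i).val < n / 2 then 0 else η i with hb
  have hterm : ∀ i j,
      (if i = j then 0 else bipartiteDist n D (x i) (x j) ^ p * (η i * η j)) =
        D ^ p * (a i * a j) + D ^ p * (b i * b j) + a i * b j + b i * a j -
          (if i = j then D ^ p * η i ^ 2 else 0) := by
    intro i j
    by_cases hij : i = j
    · subst hij
      by_cases hi : (x i).val < n / 2 <;> simp [ha, hb, hi, sq]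
    · have hxij : x i ≠ x j := fun h => hij (hx h)
      by_cases hi : (x i).val < n / 2 <;> by_cases hj : (x j).val < n / 2 <;>
        simp [ha, hb, hi, hj, hij, hxij, bipartiteDist]
  have hsq := sum_filter_add_sum_filter_not univ (fun i => (x i).val < n / 2) (fun i => η i ^ 2)
  have hA : ∑ i with (x i).val < n / 2, η i = ∑ i, a i := sum_filter _ _
  have hB : ∑ i with ¬ (x i).val < n / 2, η i = ∑ i, b i := by
    simp only [sum_filter, ite_not, hb]
  simp only [hterm, sum_sub_distrib, sum_add_distrib, ← mul_sum, ← sum_mul, sum_ite_eq,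
    mem_univ, if_true]
  rw [← hsq, hA, hB]
  ring

lemma bipartiteDist_triangle {n : ℕ} {D : ℝ} (h1 : 1 ≤ D) (h2 : D ≤ 2) (x y z : Fin n) :
    bipartiteDist n D x z ≤ bipartiteDist n D x y + bipartiteDist n D y z := by
  unfold bipartiteDist
  split_ifs <;> first | linarith | (exfalso; simp_all)

lemma sq_sum_div_card_le_of_injective {ι α : Type*} [Fintype ι] [Fintype α]
    {x : ι → α} (hx : Function.Injective x) (P : α → Prop) [DecidablePred P] (η : ι → ℝ) {m : ℕ}
    (hm : 0 < m) (hcard : #{v | P v} = m) :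
    (∑ i with P (x i), η i) ^ 2 / m ≤ ∑ i with P (x i), η i ^ 2 := by
  have hle : #{i | P (x i)} ≤ m := by
    rw [← hcard]
    exact card_le_card_of_injOn x (by intro i; simp) hx.injOn
  rw [div_le_iff₀ (by exact_mod_cast hm), mul_comm]
  exact sq_sum_le_card_mul_sum_sq.trans
    (mul_le_mul_of_nonneg_right (by exact_mod_cast hle) (sum_nonneg fun i _ => sq_nonneg _))

lemma bipartiteDist_negativeType_iff {n : ℕ} (hn : 2 ≤ n) {D p : ℝ} (hD : 0 ≤ D) :
    (∀ (k : ℕ), 2 ≤ k → ∀ x : Fin k → Fin n, Function.Injective x →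
      ∀ η : Fin k → ℝ, (∑ l, η l = 0) →
        ∑ i, ∑ j, (if i = j then 0 else
          bipartiteDist n D (x i) (x j) ^ p * (η i * η j)) ≤ 0) ↔
      D ^ p * (1 - 1 / 2 * (1 / ((n / 2 : ℕ) : ℝ) + 1 / (((n + 1) / 2 : ℕ) : ℝ))) ≤ 1 := by
  have hq : 0 < n / 2 := by omega
  have ht : 0 < (n + 1) / 2 := by omega
  have hq' : ((n / 2 : ℕ) : ℝ) ≠ 0 := by exact_mod_cast hq.ne'
  have ht' : (((n + 1) / 2 : ℕ) : ℝ) ≠ 0 := by exact_mod_cast ht.ne'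
  constructor
  · intro h
    let η : Fin n → ℝ := fun v =>
      if v.val < n / 2 then 1 / ((n / 2 : ℕ) : ℝ) else -(1 / (((n + 1) / 2 : ℕ) : ℝ))
    have lower (f : ℝ → ℝ) : ∑ v with v.val < n / 2, f (η v) =
        ((n / 2 : ℕ) : ℝ) * f (1 / ((n / 2 : ℕ) : ℝ)) := by
      rw [← card_lower_half n, ← nsmul_eq_mul, ← sum_const, card_lower_half n]
      refine sum_congr rfl fun v hv => ?_
      simp only [mem_filter, mem_univ, true_and] at hv
      simp only [η, if_pos hv]
    have upper (f : ℝ → ℝ) : ∑ v with ¬ v.val < n / 2, f (η v) =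
        (((n + 1) / 2 : ℕ) : ℝ) * f (-(1 / (((n + 1) / 2 : ℕ) : ℝ))) := by
      rw [← card_upper_half n, ← nsmul_eq_mul, ← sum_const, card_upper_half n]
      refine sum_congr rfl fun v hv => ?_
      simp only [mem_filter, mem_univ, true_and] at hv
      simp only [η, if_neg hv]
    have hA : ∑ v with v.val < n / 2, η v = 1 := by
      rw [lower fun r => r]
      field_simp
    have hB : ∑ v with ¬ v.val < n / 2, η v = -1 := by
      rw [upper fun r => r]
      field_simp
    have hsum : ∑ v, η v = 0 := by
      rw [← sum_filter_add_sum_filter_not univ (fun v : Fin n => v.val < n / 2), hA, hB]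
      norm_num
    have key := h n hn id Function.injective_id η hsum
    rw [bipartiteDist_quadratic_form D p Function.injective_id] at key
    simp only [id] at key
    rw [hA, hB, lower fun r => r ^ 2, upper fun r => r ^ 2] at key
    have e1 : ((n / 2 : ℕ) : ℝ) * (1 / ((n / 2 : ℕ) : ℝ)) ^ 2 = 1 / ((n / 2 : ℕ) : ℝ) := by
      field_simp
    have e2 : (((n + 1) / 2 : ℕ) : ℝ) * (-(1 / (((n + 1) / 2 : ℕ) : ℝ))) ^ 2 =
        1 / (((n + 1) / 2 : ℕ) : ℝ) := by
      field_simp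
    rw [e1, e2] at key
    linarith
  · intro h k _ x hx η hη
    rw [bipartiteDist_quadratic_form D p hx]
    have hA := sq_sum_div_card_le_of_injective hx (fun v => v.val < n / 2) η hq
      (card_lower_half n)
    have hB := sq_sum_div_card_le_of_injective hx (fun v => ¬ v.val < n / 2) η ht
      (card_upper_half n)
    rw [← sum_filter_add_sum_filter_not univ (fun i => (x i).val < n / 2)] at hη
    rw [eq_neg_of_add_eq_zero_right hη] at hB ⊢
    set s := ∑ i with (x i).val < n / 2, η i
    have hw : 0 ≤ D ^ p := Real.rpow_nonneg hD p
    have hs := mul_le_mul_of_nonneg_left h (sq_nonneg s)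
    have hA' := mul_le_mul_of_nonneg_left hA hw
    have hB' := mul_le_mul_of_nonneg_left hB hw
    rw [neg_sq] at hB' ⊢
    rw [div_eq_mul_one_div] at hA' hB'
    linarith

/-- Remark 4.2, general form: for every integer `n ≥ 3` and every real
`𝔇 ∈ (1,2]` there exists a metric `d` on an `n`-point set whose scaled diameter
`(diam X)/min{d(x,y) : x ≠ y}` equals `𝔇` and whose maximal `p`-negative type is exactly
`ζ(n,𝔇) = ln(1/(1−Γ))/ln 𝔇`, where `Γ = (1/2)(1/⌊n/2⌋ + 1/⌈n/2⌉)`: the space has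
`p`-negative type precisely for `0 ≤ p ≤ ζ(n,𝔇)`. -/
theorem exists_optimal_metric_space (n : ℕ) (hn : 3 ≤ n)
    (𝔇 : ℝ) (h𝔇1 : 1 < 𝔇) (h𝔇2 : 𝔇 ≤ 2)
    (Γ ζ : ℝ)
    (hΓ : Γ = 1 / 2 * (1 / ((n / 2 : ℕ) : ℝ) + 1 / (((n + 1) / 2 : ℕ) : ℝ)))
    (hζ : ζ = Real.log (1 / (1 - Γ)) / Real.log 𝔇) :
    ∃ d : Fin n → Fin n → ℝ,
      ((∀ x, d x x = 0) ∧ (∀ x y, d x y = d y x) ∧ (∀ x y, x ≠ y → 0 < d x y) ∧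
        (∀ x y z, d x z ≤ d x y + d y z)) ∧
      (∃ Dmax Dmin : ℝ,
        IsGreatest {r : ℝ | ∃ x y : Fin n, r = d x y} Dmax ∧
        IsLeast {r : ℝ | ∃ x y : Fin n, x ≠ y ∧ r = d x y} Dmin ∧
        Dmax / Dmin = 𝔇) ∧
      (∀ p : ℝ, 0 ≤ p →
        ((∀ (k : ℕ), 2 ≤ k → ∀ x : Fin k → Fin n, Function.Injective x →
            ∀ η : Fin k → ℝ, (∑ l, η l = 0) →
              ∑ i, ∑ j, (if i = j then 0 else d (x i) (x j) ^ p * (η i * η j)) ≤ 0) ↔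
          p ≤ ζ)) := by
  have hlow : (1 : ℝ) ≤ ((n / 2 : ℕ) : ℝ) := by exact_mod_cast (by omega : 1 ≤ n / 2)
  have hupp : (2 : ℝ) ≤ (((n + 1) / 2 : ℕ) : ℝ) := by
    exact_mod_cast (by omega : 2 ≤ (n + 1) / 2)
  have hΓ1 : 0 < 1 - Γ := by
    have h1 := one_div_le_one_div_of_le one_pos hlow
    have h2 := one_div_le_one_div_of_le two_pos hupp
    rw [hΓ]
    linarith
  refine ⟨bipartiteDist n 𝔇, ⟨?_, ?_, ?_, bipartiteDist_triangle h𝔇1.le h𝔇2⟩,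
    ⟨𝔇, 1, ⟨?_, ?_⟩, ⟨?_, ?_⟩, div_one 𝔇⟩, ?_⟩
  · intro x
    simp [bipartiteDist]
  · intro x y
    simp only [bipartiteDist, eq_comm, iff_comm]
  · intro x y hxy
    rw [bipartiteDist, if_neg hxy]
    split_ifs <;> linarith
  · refine ⟨⟨n - 2, by omega⟩, ⟨n - 1, by omega⟩, ?_⟩
    rw [bipartiteDist, if_neg, if_pos]
    · simp only
      omega
    · simp only [Fin.mk.injEq]
      omega
  · rintro _ ⟨x, y, rfl⟩
    unfold bipartiteDist
    split_ifs <;> linarith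
  · have hne : (⟨0, by omega⟩ : Fin n) ≠ ⟨n - 1, by omega⟩ := by
      simp only [ne_eq, Fin.mk.injEq]
      omega
    refine ⟨_, _, hne, ?_⟩
    rw [bipartiteDist, if_neg hne, if_neg]
    simp only
    omega
  · rintro _ ⟨x, y, hxy, rfl⟩
    rw [bipartiteDist, if_neg hxy]
    split_ifs <;> linarith
  · intro p _
    rw [bipartiteDist_negativeType_iff (by omega) (by linarith), ← hΓ, hζ,
      le_div_iff₀ (Real.log_pos h𝔇1), ← Real.log_rpow (by linarith),
      Real.log_le_log_iff (Real.rpow_pos_of_pos (by linarith) p) (one_div_pos.mpr hΓ1),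
      le_div_iff₀ hΓ1]
end

section
/- Let X be a finite set with n = |X| ≥ 3 elements and let d : X × X → ℝ be a semi-metric, i.e. d(x,x) = 0 for all x, d(x,y) = d(y,x) > 0 for all x ≠ y (the triangle inequality is not assumed). Suppose 𝔇 = max{d(x,y)} / min{d(x,y) : x ≠ y} > 1, and set Γ = (1/2)(1/⌊n/2⌋ + 1/⌈n/2⌉) and ζ = ln(1/(1−Γ))/ln 𝔇. Then (X,d) has p-negative type for all 0 ≤ p ≤ ζ, and strict p-negative type for all 0 ≤ p < ζ. -/
open Finset in
/-- Cauchy-Schwarz for a function, counting only the points where it is positive. -/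
lemma sq_sum_posPart_le {ι : Type*} [Fintype ι] (f : ι → ℝ) :
    (∑ i, max (f i) 0) ^ 2 ≤ #{i | 0 < f i} * ∑ i, max (f i) 0 ^ 2 := by
  have h1 : ∑ i, max (f i) 0 = ∑ i with 0 < f i, max (f i) 0 := by
    rw [sum_filter]
    refine sum_congr rfl fun i _ => ?_
    split_ifs with h
    · rfl
    · exact max_eq_right (not_lt.1 h)
  rw [h1]
  refine sq_sum_le_card_mul_sum_sq.trans ?_
  gcongr
  exact subset_univ _

/-- Among pairs of positive integers with sum at most `n`, the sum of reciprocals is minimised by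
the most balanced splitting of `n`. -/
lemma inv_half_add_inv_half_le {n s t : ℕ} (hs : 0 < s) (ht : 0 < t) (hst : s + t ≤ n) :
    1 / ((n / 2 : ℕ) : ℝ) + 1 / (((n + 1) / 2 : ℕ) : ℝ) ≤ 1 / (s : ℝ) + 1 / (t : ℝ) := by
  wlog h : s ≤ t generalizing s t
  · rw [add_comm (1 / (s : ℝ))]
    exact this ht hs (by omega) (by omega)
  obtain ⟨f, hf⟩ : ∃ f, f = n / 2 := ⟨_, rfl⟩
  obtain ⟨c, hc⟩ : ∃ c, c = (n + 1) / 2 := ⟨_, rfl⟩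
  rw [← hf, ← hc]
  have hsf : (s : ℝ) ≤ f := by exact_mod_cast (by omega : s ≤ f)
  have hfc : (f : ℝ) ≤ c := by exact_mod_cast (by omega : f ≤ c)
  have hsum : (s : ℝ) + t ≤ f + c := by exact_mod_cast (by omega : s + t ≤ f + c)
  have hs0 : (0 : ℝ) < s := by exact_mod_cast hs
  have ht0 : (0 : ℝ) < t := by exact_mod_cast ht
  have hf0 : (0 : ℝ) < f := hs0.trans_le hsf
  have hc0 : (0 : ℝ) < c := hf0.trans_le hfc
  have hu0 : (0 : ℝ) < f + c - s := by linarith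
  calc 1 / (f : ℝ) + 1 / (c : ℝ) ≤ 1 / (s : ℝ) + 1 / ((f : ℝ) + c - s) := by
        rw [div_add_div _ _ hf0.ne' hc0.ne', div_add_div _ _ hs0.ne' hu0.ne',
          div_le_div_iff₀ (by positivity) (by positivity)]
        nlinarith [mul_nonneg (add_pos hf0 hc0).le
          (mul_nonneg (sub_nonneg.2 hsf) (sub_nonneg.2 (hsf.trans hfc)))]
    _ ≤ 1 / (s : ℝ) + 1 / (t : ℝ) := by
        gcongr
        linarith

/-- A number `w ∈ [m, M]` times a product `x * y`, bounded through positive and negative parts. -/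
lemma mul_mul_le_posPart_negPart {m M w : ℝ} (hm : m ≤ w) (hM : w ≤ M) (x y : ℝ) :
    w * (x * y) ≤ M * (max x 0 * max y 0 + max (-x) 0 * max (-y) 0)
      - m * (max x 0 * max (-y) 0 + max (-x) 0 * max y 0) := by
  rcases le_total 0 x with hx | hx <;> rcases le_total 0 y with hy | hy <;>
    simp only [hx, hy, max_eq_left, max_eq_right, neg_nonneg, neg_nonpos]
  · nlinarith [mul_nonneg (sub_nonneg.2 hM) (mul_nonneg hx hy)]
  · nlinarith [mul_nonneg (sub_nonneg.2 hm) (mul_nonneg hx (neg_nonneg.2 hy))]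
  · nlinarith [mul_nonneg (sub_nonneg.2 hm) (mul_nonneg (neg_nonneg.2 hx) hy)]
  · nlinarith [mul_nonneg (sub_nonneg.2 hM) (mul_nonneg (neg_nonneg.2 hx) (neg_nonneg.2 hy))]

open Finset in
/-- A quadratic form with zero diagonal and off-diagonal entries in `[m, M]`, evaluated at a vector
with vanishing coordinate sum. -/
lemma sum_sum_offDiag_le {ι : Type*} [Fintype ι] [DecidableEq ι] {n : ℕ}
    (hn : Fintype.card ι ≤ n) {m M : ℝ} (hM0 : 0 ≤ M) (w : ι → ι → ℝ)
    (hw : ∀ i j, i ≠ j → m ≤ w i j ∧ w i j ≤ M) (η : ι → ℝ) (hη : ∑ i, η i = 0) :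
    ∑ i, ∑ j, (if i = j then 0 else w i j * (η i * η j)) ≤
      2 * (∑ i, max (η i) 0) ^ 2 * (M * (1 - 1 / 2 * (1 / ((n / 2 : ℕ) : ℝ)
        + 1 / (((n + 1) / 2 : ℕ) : ℝ))) - m) := by
  set S := ∑ i, max (η i) 0 with hS
  have hS' : ∑ i, max (-η i) 0 = S := by
    have h : ∑ i, (max (η i) 0 - max (-η i) 0) = ∑ i, η i :=
      sum_congr rfl fun i _ => by rcases le_total 0 (η i) with h | h <;> simp [h]
    rw [sum_sub_distrib, hη] at h
    linarith
  set P := ∑ i, max (η i) 0 ^ 2 with hP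
  set N := ∑ i, max (-η i) 0 ^ 2 with hN
  have hform : ∑ i, ∑ j, (if i = j then 0 else w i j * (η i * η j)) ≤
      M * (2 * S ^ 2) - m * (2 * S ^ 2) - M * (P + N) := by
    calc _ ≤ ∑ i, ∑ j, (M * (max (η i) 0 * max (η j) 0 + max (-η i) 0 * max (-η j) 0)
          - m * (max (η i) 0 * max (-η j) 0 + max (-η i) 0 * max (η j) 0)
          - if i = j then M * (max (η i) 0 ^ 2 + max (-η i) 0 ^ 2) else 0) := by
          refine sum_le_sum fun i _ => sum_le_sum fun j _ => ?_
          split_ifs with h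
          · subst h
            rcases le_total 0 (η i) with h | h <;> simp [h] <;> nlinarith
          · rw [sub_zero]
            exact mul_mul_le_posPart_negPart (hw i j h).1 (hw i j h).2 _ _
      _ = _ := by
          simp only [sum_sub_distrib, ← mul_sum, sum_add_distrib, ← sum_mul, sum_ite_eq,
            mem_univ, if_true, hS', ← hS, ← hP, ← hN]
          ring
  refine hform.trans ?_
  have hS0 : 0 ≤ S := sum_nonneg fun i _ => le_max_right (η i) 0
  rcases hS0.eq_or_lt with h0 | h0
  · have : 0 ≤ M * (P + N) := by positivity
    rw [← h0]
    linarith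
  have hPc : S ^ 2 ≤ #{i | 0 < η i} * P := sq_sum_posPart_le η
  have hNc : S ^ 2 ≤ #{i | 0 < -η i} * N := hS' ▸ sq_sum_posPart_le fun i => -η i
  have hcard : #{i | 0 < η i} + #{i | 0 < -η i} ≤ n := by
    rw [← card_union_of_disjoint]
    · exact (card_le_univ _).trans hn
    · refine disjoint_filter.2 fun i _ h => ?_
      linarith
  generalize #{i | 0 < η i} = s at *
  generalize #{i | 0 < -η i} = t at *
  have hS2 : 0 < S ^ 2 := by positivity
  have hs : 0 < s := Nat.pos_of_ne_zero fun h => by simp [h] at hPc; nlinarith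
  have ht : 0 < t := Nat.pos_of_ne_zero fun h => by simp [h] at hNc; nlinarith
  have hs' : (0 : ℝ) < s := by exact_mod_cast hs
  have ht' : (0 : ℝ) < t := by exact_mod_cast ht
  have hP' : S ^ 2 * (1 / s) ≤ P := by
    rw [mul_one_div, div_le_iff₀ hs']
    linarith
  have hN' : S ^ 2 * (1 / t) ≤ N := by
    rw [mul_one_div, div_le_iff₀ ht']
    linarith
  have hPN : S ^ 2 * (1 / ((n / 2 : ℕ) : ℝ) + 1 / (((n + 1) / 2 : ℕ) : ℝ)) ≤ P + N :=
    (mul_le_mul_of_nonneg_left (inv_half_add_inv_half_le hs ht hcard) hS2.le).trans (by linarith)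
  linarith [mul_le_mul_of_nonneg_left hPN hM0]


/-- Remark 4.3: Theorem 4.1 for finite semi-metric spaces.  If `X` is a
finite set with `n = |X| ≥ 3` carrying a semi-metric `d` (so `d(x,x) = 0`,
`d(x,y) = d(y,x) > 0` for `x ≠ y`; no triangle inequality) whose scaled diameter
`𝔇 = max{d(x,y)}/min{d(x,y) : x ≠ y}` exceeds `1`, then `(X,d)` has `p`-negative type for
all `0 ≤ p ≤ ζ` and strict `p`-negative type for all `0 ≤ p < ζ`, where
`ζ = ln(1/(1−Γ))/ln 𝔇` and `Γ = (1/2)(1/⌊n/2⌋ + 1/⌈n/2⌉)`. -/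
theorem semimetric_negative_type_lower_bound {X : Type*} [Fintype X]
    (hn : 3 ≤ Fintype.card X)
    (d : X → X → ℝ)
    (hzero : ∀ x, d x x = 0) (hsymm : ∀ x y, d x y = d y x)
    (hpos : ∀ x y, x ≠ y → 0 < d x y)
    (Dmax Dmin 𝔇 : ℝ)
    (hmax : IsGreatest {r : ℝ | ∃ x y : X, r = d x y} Dmax)
    (hmin : IsLeast {r : ℝ | ∃ x y : X, x ≠ y ∧ r = d x y} Dmin)
    (h𝔇 : 𝔇 = Dmax / Dmin) (h𝔇1 : 1 < 𝔇)
    (Γ ζ : ℝ)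
    (hΓ : Γ = 1 / 2 * (1 / ((Fintype.card X / 2 : ℕ) : ℝ)
        + 1 / (((Fintype.card X + 1) / 2 : ℕ) : ℝ)))
    (hζ : ζ = Real.log (1 / (1 - Γ)) / Real.log 𝔇) :
    (∀ p : ℝ, 0 ≤ p → p ≤ ζ →
      ∀ (k : ℕ), 2 ≤ k → ∀ x : Fin k → X, Function.Injective x →
        ∀ η : Fin k → ℝ, (∑ l, η l = 0) →
          ∑ i, ∑ j, (if i = j then 0 else d (x i) (x j) ^ p * (η i * η j)) ≤ 0) ∧
    (∀ p : ℝ, 0 ≤ p → p < ζ →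
      ∀ (k : ℕ), 2 ≤ k → ∀ x : Fin k → X, Function.Injective x →
        ∀ η : Fin k → ℝ, (∑ l, η l = 0) → η ≠ 0 →
          ∑ i, ∑ j, (if i = j then 0 else d (x i) (x j) ^ p * (η i * η j)) < 0) := by
  have hΓ1 : 0 < 1 - Γ := by
    have h1 : (1 : ℝ) ≤ (Fintype.card X / 2 : ℕ) := by
      exact_mod_cast (by omega : 1 ≤ Fintype.card X / 2)
    have h2 : (2 : ℝ) ≤ ((Fintype.card X + 1) / 2 : ℕ) := by
      exact_mod_cast (by omega : 2 ≤ (Fintype.card X + 1) / 2)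
    have h3 := one_div_le_one_div_of_le one_pos h1
    have h4 := one_div_le_one_div_of_le two_pos h2
    rw [hΓ]
    linarith
  have hlog : 0 < Real.log 𝔇 := Real.log_pos h𝔇1
  have hDmin : 0 < Dmin := by
    obtain ⟨x, y, hxy, h⟩ := hmin.1
    exact h ▸ hpos x y hxy
  have hDmax : Dmax = 𝔇 * Dmin := by rw [h𝔇, div_mul_cancel₀ _ hDmin.ne']
  have h𝔇0 : 0 < 𝔇 := one_pos.trans h𝔇1
  have hDmaxp (p : ℝ) : Dmax ^ p * (1 - Γ) - Dmin ^ p = Dmin ^ p * (𝔇 ^ p * (1 - Γ) - 1) := by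
    rw [hDmax, Real.mul_rpow h𝔇0.le hDmin.le]
    ring
  have hζlog : Real.log 𝔇 * ζ = Real.log (1 / (1 - Γ)) := by
    rw [hζ, mul_div_cancel₀ _ hlog.ne']
  have h𝔇ζ : 𝔇 ^ ζ * (1 - Γ) = 1 := by
    rw [Real.rpow_def_of_pos h𝔇0, hζlog, Real.exp_log (by positivity),
      one_div_mul_cancel hΓ1.ne']
  have key (p : ℝ) (hp : 0 ≤ p) (k : ℕ) (x : Fin k → X) (hx : Function.Injective x)
      (η : Fin k → ℝ) (hη : ∑ l, η l = 0) :
      ∑ i, ∑ j, (if i = j then 0 else d (x i) (x j) ^ p * (η i * η j)) ≤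
        2 * (∑ i, max (η i) 0) ^ 2 * (Dmin ^ p * (𝔇 ^ p * (1 - Γ) - 1)) := by
    rw [← hDmaxp, hΓ]
    refine sum_sum_offDiag_le (Fintype.card_le_of_injective x hx)
      (Real.rpow_nonneg (hDmax ▸ by positivity) p) (fun i j => d (x i) (x j) ^ p)
      (fun i j hij => ?_) η hη
    have hne : x i ≠ x j := hx.ne hij
    exact ⟨Real.rpow_le_rpow hDmin.le (hmin.2 ⟨_, _, hne, rfl⟩) hp,
      Real.rpow_le_rpow (hpos _ _ hne).le (hmax.2 ⟨_, _, rfl⟩) hp⟩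
  refine ⟨fun p hp hpζ k _ x hx η hη => (key p hp k x hx η hη).trans ?_,
    fun p hp hpζ k _ x hx η hη hη0 => (key p hp k x hx η hη).trans_lt ?_⟩
  · have h := mul_le_mul_of_nonneg_right (Real.rpow_le_rpow_of_exponent_le h𝔇1.le hpζ) hΓ1.le
    refine mul_nonpos_of_nonneg_of_nonpos (by positivity)
      (mul_nonpos_of_nonneg_of_nonpos (by positivity) (by linarith))
  · have h := mul_lt_mul_of_pos_right (Real.rpow_lt_rpow_of_exponent_lt h𝔇1 hpζ) hΓ1
    obtain ⟨i, -, hi⟩ : ∃ i ∈ Finset.univ, 0 < η i :=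
      Finset.exists_pos_of_sum_zero_of_exists_nonzero η hη
        ((Function.ne_iff.1 hη0).imp fun i hi => ⟨Finset.mem_univ i, hi⟩)
    have hS : 0 < ∑ i, max (η i) 0 :=
      Finset.sum_pos' (fun i _ => le_max_right _ _) ⟨i, Finset.mem_univ i, lt_max_of_lt_left hi⟩
    exact mul_neg_of_pos_of_neg (by positivity)
      (mul_neg_of_pos_of_neg (by positivity) (by linarith))
end
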